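/- Let G be an abelian group, T an injective aperiodic endomorphism of G (i.e. for every integer m ≥ 1 and g ∈ G, T^m g = g implies g = 0), and X a finite subset of G. Then there exists n₀ ∈ ℕ such that for all n ≥ n₀ and all k ∈ ℕ, the map X^k → G sending (x_1, …, x_k) to ∑_{l=1}^{k} T^{n(l-1)} x_l is injective. -/

import Mathlib

open Polynomial

theorem transcendental_of_pow_ne_one {A : Type*} [CommRing A] [IsDomain A] (p : ℕ)
    [Fact p.Prime] [Algebra (ZMod p) A] {a : A}
    (hsurj : Function.Surjective (aeval a : (ZMod p)[X] →ₐ[ZMod p] A))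
    (h0 : a ≠ 0) (h1 : ∀ m : ℕ, 1 ≤ m → a ^ m ≠ 1) : Transcendental (ZMod p) a := by
  intro halg
  have hfg := halg.isIntegral.fg_adjoin_singleton
  rw [Algebra.adjoin_singleton_eq_range_aeval, (AlgHom.range_eq_top _).2 hsurj] at hfg
  have : Module.Finite (ZMod p) A := ⟨by simpa using hfg⟩
  have : Finite A := Module.finite_of_finite (ZMod p)
  obtain ⟨i, j, hij, hne⟩ : ∃ i j, a ^ i = a ^ j ∧ i ≠ j := by
    simpa [Function.Injective] using not_injective_infinite_finite (fun n : ℕ => a ^ n)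
  wlog hlt : i < j generalizing i j
  · exact this j i hij.symm hne.symm (by lia)
  refine h1 (j - i) (by lia) (mul_left_cancel₀ (pow_ne_zero i h0) ?_)
  rw [← pow_add, mul_one, hij]
  congr 1
  lia

theorem exists_absoluteValue_ne_one_of_charP {A : Type*} [CommRing A] [IsDomain A] (p : ℕ)
    [Fact p.Prime] [CharP A p] {a : A}
    (hsurj : Function.Surjective (aeval a : ℤ[X] →ₐ[ℤ] A))
    (h0 : a ≠ 0) (h1 : ∀ m : ℕ, 1 ≤ m → a ^ m ≠ 1) : ∃ v : AbsoluteValue A ℝ, v a ≠ 1 := by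
  let := ZMod.algebra A p
  have hsurj' : Function.Surjective (aeval a : (ZMod p)[X] →ₐ[ZMod p] A) := fun x => by
    obtain ⟨q, rfl⟩ := hsurj x
    exact ⟨q.map (Int.castRingHom (ZMod p)), by
      rw [aeval_def, aeval_def, eval₂_map]
      congr 1
      exact RingHom.ext_int _ _⟩
  have hinj := transcendental_iff_injective.1 (transcendental_of_pow_ne_one p hsurj' h0 h1)
  let e := AlgEquiv.ofBijective (aeval a : (ZMod p)[X] →ₐ[ZMod p] A) ⟨hinj, hsurj'⟩
  have he : e.symm a = X := e.symm_apply_eq.2 (aeval_X a).symm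
  let v : AbsoluteValue (ZMod p)[X] ℝ :=
    { toFun := fun q => (cardPowDegree q : ℝ)
      map_mul' := by simp
      nonneg' := fun q => by exact_mod_cast cardPowDegree.nonneg q
      eq_zero' := by simp
      add_le' := fun q r => by exact_mod_cast cardPowDegree.add_le q r }
  refine ⟨v.comp (f := e.symm.toRingEquiv.toRingHom) e.symm.injective, ?_⟩
  have : v.comp (f := e.symm.toRingEquiv.toRingHom) e.symm.injective a = p := by
    change ((cardPowDegree (e.symm a) : ℤ) : ℝ) = p
    simp [he, ZMod.card]
  rw [this]
  exact_mod_cast (Fact.out : p.Prime).one_lt.ne'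

theorem exists_absoluteValue_ne_one_of_transcendental {A : Type*} [CommRing A] {a : A}
    (hsurj : Function.Surjective (aeval a : ℤ[X] →ₐ[ℤ] A)) (ha : Transcendental ℤ a) :
    ∃ v : AbsoluteValue A ℝ, v a ≠ 1 := by
  let e := AlgEquiv.ofBijective (aeval a : ℤ[X] →ₐ[ℤ] A)
    ⟨transcendental_iff_injective.1 ha, hsurj⟩
  have he : e.symm a = X := e.symm_apply_eq.2 (aeval_X a).symm
  have hr := transcendental_liouvilleNumber (m := 2) le_rfl
  set r := liouvilleNumber (2 : ℕ)
  refine ⟨AbsoluteValue.abs.comp (f := ((aeval r).comp e.symm.toAlgHom).toRingHom)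
    ((transcendental_iff_injective.1 hr).comp e.symm.injective), fun h => ?_⟩
  have : |r| = 1 := by
    rw [← h]
    change |r| = |aeval r (e.symm a)|
    simp [he]
  rcases (abs_eq zero_le_one).1 this with h | h
  · exact hr (h ▸ isAlgebraic_one)
  · exact hr (h ▸ isAlgebraic_one.neg)

/-- In a number field, a nonzero element that is not a root of unity has some absolute value
different from one. -/
theorem NumberField.exists_absoluteValue_ne_one {K : Type*} [Field K] [NumberField K] {a : K}
    (h1 : ∀ m : ℕ, 1 ≤ m → a ^ m ≠ 1) : ∃ v : AbsoluteValue K ℝ, v a ≠ 1 := by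
  by_contra! hv
  have hint : IsIntegral ℤ a := by
    obtain ⟨b, rfl⟩ := IsDedekindDomain.HeightOneSpectrum.mem_integers_of_valuation_le_one
      (R := NumberField.RingOfIntegers K) K a fun v => by
        have := hv (v.adicAbv (NumberField.HeightOneSpectrum.one_lt_absNorm_nnreal v))
        simp only [IsDedekindDomain.HeightOneSpectrum.adicAbv, AbsoluteValue.coe_mk, MulHom.coe_mk,
          IsDedekindDomain.HeightOneSpectrum.adicAbvDef, NNReal.coe_eq_one] at this
        exact ((WithZeroMulInt.toNNReal_eq_one_iff _ _
          (NumberField.HeightOneSpectrum.one_lt_absNorm_nnreal v).ne').1 this).le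
    exact b.isIntegral_coe
  obtain ⟨n, hn, h⟩ := NumberField.Embeddings.pow_eq_one_of_norm_eq_one K ℂ hint fun φ =>
    hv ((NormedField.toAbsoluteValue ℂ).comp φ.injective)
  exact h1 n hn h

theorem exists_absoluteValue_ne_one_of_isAlgebraic {A : Type*} (K : Type*) [CommRing A] [IsDomain A]
    [CharZero A] [Field K] [Algebra A K] [IsFractionRing A K] {a : A}
    (hsurj : Function.Surjective (aeval a : ℤ[X] →ₐ[ℤ] A))
    (ha : IsAlgebraic ℤ a) (h1 : ∀ m : ℕ, 1 ≤ m → a ^ m ≠ 1) :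
    ∃ v : AbsoluteValue A ℝ, v a ≠ 1 := by
  let b : K := algebraMap A K a
  have : CharZero K := IsFractionRing.charZero_of_isFractionRing A
  have hb : IsIntegral ℚ b := by
    have hbalg : IsAlgebraic ℤ b := ha.algebraMap
    exact (hbalg.extendScalars (Int.cast_injective (α := ℚ))).isIntegral
  let L := IntermediateField.adjoin ℚ {b}
  have : FiniteDimensional ℚ L := IntermediateField.adjoin.finiteDimensional hb
  have : NumberField L := {}
  have hbL : b ∈ L := IntermediateField.mem_adjoin_simple_self ℚ b
  have hmem : ∀ x, algebraMap A K x ∈ L := fun x => by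
    obtain ⟨q, rfl⟩ := hsurj x
    have : algebraMap A K (aeval a q) = aeval b q := (aeval_algebraMap_apply K a q).symm
    rw [this, aeval_eq_sum_range]
    exact sum_mem fun i _ => zsmul_mem (S := IntermediateField ℚ K) (pow_mem hbL i) _
  have hinj : Function.Injective (algebraMap A K) := IsFractionRing.injective A K
  obtain ⟨v, hv⟩ := NumberField.exists_absoluteValue_ne_one (K := L) (a := ⟨b, hbL⟩) fun m hm h =>
    h1 m hm (hinj (by simpa [b] using congrArg Subtype.val h))
  exact ⟨v.comp (f := (algebraMap A K).codRestrict L hmem)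
    fun x y h => hinj (congrArg Subtype.val h), hv⟩

/-- A domain generated by one element that is nonzero and not a root of unity has an absolute value
at which the generator does not have absolute value one. -/
theorem exists_absoluteValue_ne_one {A : Type*} [CommRing A] [IsDomain A] {a : A}
    (hsurj : Function.Surjective (aeval a : ℤ[X] →ₐ[ℤ] A))
    (h0 : a ≠ 0) (h1 : ∀ m : ℕ, 1 ≤ m → a ^ m ≠ 1) : ∃ v : AbsoluteValue A ℝ, v a ≠ 1 := by
  obtain ⟨p, hp⟩ := CharP.exists A
  rcases CharP.char_is_prime_or_zero A p with hp' | rfl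
  · have : Fact p.Prime := ⟨hp'⟩
    exact exists_absoluteValue_ne_one_of_charP p hsurj h0 h1
  · have : CharZero A := CharP.charP_to_charZero A
    by_cases ha : IsAlgebraic ℤ a
    · exact exists_absoluteValue_ne_one_of_isAlgebraic (FractionRing A) hsurj ha h1
    · exact exists_absoluteValue_ne_one_of_transcendental hsurj ha

theorem AbsoluteValue.sum_pow_mul_le_of_one_le {A : Type*} [CommRing A] (v : AbsoluteValue A ℝ)
    {C : ℝ} (hC : 0 ≤ C) {t : A} (ht : 1 ≤ v t) :
    ∀ {k : ℕ} (d : Fin k → A), (∀ l, v (d l) ≤ C) →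
      v (∑ l : Fin k, t ^ (l : ℕ) * d l) * (v t - 1) ≤ C * v t ^ k
  | 0, _, _ => by simpa using hC
  | k + 1, d, hd => by
    have ih := v.sum_pow_mul_le_of_one_le hC ht (fun l : Fin k => d l.castSucc) fun l => hd _
    rw [Fin.sum_univ_castSucc]
    simp only [Fin.val_castSucc, Fin.val_last]
    have hlast : v (t ^ k * d (Fin.last k)) ≤ v t ^ k * C := by
      rcases subsingleton_or_nontrivial A with _ | _
      · rw [Subsingleton.elim (t ^ k * d (Fin.last k)) 0, v.map_zero]
        positivity
      · rw [v.map_mul, v.map_pow]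
        gcongr
        exact hd _
    have hadd := v.add_le (∑ l : Fin k, t ^ (l : ℕ) * d l.castSucc) (t ^ k * d (Fin.last k))
    have := mul_le_mul_of_nonneg_right (hadd.trans (add_le_add_right hlast _)) (sub_nonneg.2 ht)
    calc _ ≤ _ := this
      _ ≤ C * v t ^ (k + 1) := by linear_combination ih

theorem AbsoluteValue.sum_pow_mul_le_of_le_half {A : Type*} [CommRing A] (v : AbsoluteValue A ℝ)
    {C : ℝ} (hC : 0 ≤ C) {t : A} (ht : v t ≤ 1 / 2) :
    ∀ {k : ℕ} (d : Fin k → A), (∀ l, v (d l) ≤ C) → v (∑ l : Fin k, t ^ (l : ℕ) * d l) ≤ 2 * C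
  | 0, _, _ => by simpa using hC
  | k + 1, d, hd => by
    have ih := v.sum_pow_mul_le_of_le_half hC ht (fun l : Fin k => d l.succ) fun l => hd _
    rw [Fin.sum_univ_succ]
    simp only [Fin.val_zero, Fin.val_succ, pow_zero, one_mul, pow_succ', mul_assoc,
      ← Finset.mul_sum]
    refine (v.add_le _ _).trans ?_
    rw [v.map_mul]
    have := mul_le_mul ht ih (v.nonneg _) (by norm_num)
    linarith [hd 0]

theorem AbsoluteValue.eq_zero_of_sum_pow_mul_eq_zero_of_gt {A : Type*} [CommRing A]
    [Nontrivial A] (v : AbsoluteValue A ℝ) {C : ℝ} (hC : 1 ≤ C) {t : A} (ht : 1 + C * C < v t) :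
    ∀ {k : ℕ} (d : Fin k → A), (∀ l, v (d l) ≤ C) → (∀ l, d l ≠ 0 → 1 ≤ C * v (d l)) →
      ∑ l : Fin k, t ^ (l : ℕ) * d l = 0 → ∀ l, d l = 0
  | 0, _, _, _, _ => fun l => l.elim0
  | k + 1, d, hd, hd', h => by
    rw [Fin.sum_univ_castSucc] at h
    simp only [Fin.val_castSucc, Fin.val_last] at h
    have hlast : d (Fin.last k) = 0 := by
      by_contra hne
      have hb := v.sum_pow_mul_le_of_one_le (by linarith) (by nlinarith : 1 ≤ v t)
        (fun l : Fin k => d l.castSucc) fun l => hd _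
      rw [eq_neg_of_add_eq_zero_left h, v.map_neg, v.map_mul, v.map_pow] at hb
      have hpos : 0 < v t ^ k := pow_pos (by nlinarith) k
      have hle : v (d (Fin.last k)) * (v t - 1) ≤ C :=
        le_of_mul_le_mul_left (by linarith) hpos
      have := hd' _ hne
      nlinarith
    rw [hlast, mul_zero, add_zero] at h
    exact Fin.lastCases hlast (v.eq_zero_of_sum_pow_mul_eq_zero_of_gt hC ht
      (fun l : Fin k => d l.castSucc) (fun l => hd _) (fun l => hd' _) h)

theorem AbsoluteValue.eq_zero_of_sum_pow_mul_eq_zero_of_lt {A : Type*} [CommRing A]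
    [IsDomain A] (v : AbsoluteValue A ℝ) {C : ℝ} (hC : 1 ≤ C) {t : A} (h0 : t ≠ 0)
    (ht : v t * (2 * (C * C)) < 1) :
    ∀ {k : ℕ} (d : Fin k → A), (∀ l, v (d l) ≤ C) → (∀ l, d l ≠ 0 → 1 ≤ C * v (d l)) →
      ∑ l : Fin k, t ^ (l : ℕ) * d l = 0 → ∀ l, d l = 0
  | 0, _, _, _, _ => fun l => l.elim0
  | k + 1, d, hd, hd', h => by
    rw [Fin.sum_univ_succ] at h
    simp only [Fin.val_zero, Fin.val_succ, pow_zero, one_mul, pow_succ', mul_assoc,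
      ← Finset.mul_sum] at h
    have hhalf : v t ≤ 1 / 2 := by nlinarith [v.nonneg t]
    have hfirst : d 0 = 0 := by
      by_contra hne
      have hb := mul_le_mul_of_nonneg_left (v.sum_pow_mul_le_of_le_half (by linarith) hhalf
        (fun l : Fin k => d l.succ) fun l => hd _) (v.nonneg t)
      rw [← v.map_mul, eq_neg_of_add_eq_zero_right h, v.map_neg] at hb
      have := hd' _ hne
      nlinarith
    rw [hfirst, zero_add] at h
    exact Fin.cases hfirst (v.eq_zero_of_sum_pow_mul_eq_zero_of_lt hC h0 ht
      (fun l : Fin k => d l.succ) (fun l => hd _) (fun l => hd' _)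
      ((mul_eq_zero.1 h).resolve_left h0))

theorem AbsoluteValue.exists_forall_sum_pow_mul_eq_zero {A : Type*} [CommRing A] [IsDomain A]
    (v : AbsoluteValue A ℝ) {a : A} (h0 : a ≠ 0) (hv : v a ≠ 1) (E : Finset A) :
    ∃ n₀ : ℕ, ∀ n ≥ n₀, ∀ (k : ℕ) (d : Fin k → A), (∀ l, d l ∈ E) →
      ∑ l : Fin k, (a ^ n) ^ (l : ℕ) * d l = 0 → ∀ l, d l = 0 := by
  classical
  obtain ⟨C, hC⟩ := (E.image fun x => max (v x) (v x)⁻¹).exists_le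
  obtain ⟨B, hB, hle, hge⟩ : ∃ B : ℝ, 1 ≤ B ∧ (∀ x ∈ E, v x ≤ B) ∧
      ∀ x ∈ E, x ≠ 0 → 1 ≤ B * v x :=
    have hmax : ∀ x ∈ E, max (v x) (v x)⁻¹ ≤ max 1 C := fun x hx =>
      (hC _ (Finset.mem_image_of_mem _ hx)).trans (le_max_right _ _)
    ⟨max 1 C, le_max_left _ _, fun x hx => (le_max_left _ _).trans (hmax x hx), fun x hx hne =>
      (inv_le_iff_one_le_mul₀ (v.pos hne)).1 ((le_max_right _ _).trans (hmax x hx))⟩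
  rcases hv.lt_or_gt with hlt | hgt
  · have hlim := (tendsto_pow_atTop_nhds_zero_of_lt_one (v.nonneg a) hlt).mul_const (2 * (B * B))
    rw [zero_mul] at hlim
    obtain ⟨n₀, hn₀⟩ := Filter.eventually_atTop.1 (hlim.eventually (gt_mem_nhds one_pos))
    exact ⟨n₀, fun n hn k d hd => v.eq_zero_of_sum_pow_mul_eq_zero_of_lt hB (pow_ne_zero n h0)
      (by simpa only [v.map_pow] using hn₀ n hn) d (fun l => hle _ (hd l)) fun l => hge _ (hd l)⟩
  · obtain ⟨n₀, hn₀⟩ := Filter.eventually_atTop.1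
      ((tendsto_pow_atTop_atTop_of_one_lt hgt).eventually_gt_atTop (1 + B * B))
    exact ⟨n₀, fun n hn k d hd => v.eq_zero_of_sum_pow_mul_eq_zero_of_gt hB
      (by simpa only [v.map_pow] using hn₀ n hn) d (fun l => hle _ (hd l)) fun l => hge _ (hd l)⟩

/-- The same vanishing with coefficients in the fraction field. -/
theorem AbsoluteValue.exists_forall_sum_pow_mul_algebraMap_eq_zero {A : Type*} (K : Type*)
    [CommRing A] [IsDomain A] [Field K] [Algebra A K] [IsFractionRing A K]
    (v : AbsoluteValue A ℝ) {a : A} (h0 : a ≠ 0) (hv : v a ≠ 1) (E : Finset K) :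
    ∃ n₀ : ℕ, ∀ n ≥ n₀, ∀ (k : ℕ) (d : Fin k → K), (∀ l, d l ∈ E) →
      ∑ l : Fin k, algebraMap A K (a ^ (n * l)) * d l = 0 → ∀ l, d l = 0 := by
  classical
  obtain ⟨b, hb⟩ := IsLocalization.exist_integer_multiples_of_finset (nonZeroDivisors A) E
  choose! f hf using hb
  obtain ⟨n₀, hn₀⟩ := v.exists_forall_sum_pow_mul_eq_zero h0 hv (E.image f)
  refine ⟨n₀, fun n hn k d hd h l => ?_⟩
  have hinj : Function.Injective (algebraMap A K) := IsFractionRing.injective A K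
  have hz := hn₀ n hn k (fun l => f (d l)) (fun l => Finset.mem_image_of_mem _ (hd l)) (hinj <| by
    rw [map_sum, map_zero, ← smul_zero (b : A), ← h, Finset.smul_sum]
    refine Finset.sum_congr rfl fun i _ => ?_
    rw [map_mul, hf _ (hd i), pow_mul, mul_smul_comm]) l
  have := hf _ (hd l)
  rw [hz, map_zero, eq_comm, smul_eq_zero] at this
  exact this.resolve_left (nonZeroDivisors.ne_zero b.2)

open TensorProduct in
/-- A finite module has a nonzero map to the residue field of each prime in its support. -/
theorem Module.exists_linearMap_residueField_ne_zero {R M : Type*} [CommRing R] [AddCommGroup M]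
    [Module R M] [Module.Finite R M] (p : PrimeSpectrum R) (hp : p ∈ Module.support R M) :
    ∃ φ : M →ₗ[R] p.asIdeal.ResidueField, φ ≠ 0 := by
  have := (Module.mem_support_iff_nontrivial_residueField_tensorProduct p).1 hp
  obtain ⟨z, hz⟩ := exists_ne (0 : p.asIdeal.ResidueField ⊗[R] M)
  obtain ⟨f, hf⟩ := Module.Projective.exists_dual_ne_zero p.asIdeal.ResidueField hz
  refine ⟨f.restrictScalars R ∘ₗ TensorProduct.mk R p.asIdeal.ResidueField M 1, fun h => hf ?_⟩
  have : f = 0 := TensorProduct.AlgebraTensorModule.curry_injective <| by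
    ext m
    exact LinearMap.congr_fun h m
  simp [this]

/-- A nonzero finite `ℤ[X]`-module on which multiplication by `X` is injective and aperiodic
has a nonzero map to a residue field for which the vanishing property holds. -/
theorem exists_linearMap_residueField_ne_zero {M : Type*} [AddCommGroup M] [Module ℤ[X] M]
    [Module.Finite ℤ[X] M] [Nontrivial M] (h0 : ∀ g : M, (X : ℤ[X]) • g = 0 → g = 0)
    (h1 : ∀ m : ℕ, 1 ≤ m → ∀ g : M, (X ^ m : ℤ[X]) • g = g → g = 0) :
    ∃ (p : PrimeSpectrum ℤ[X]) (φ : M →ₗ[ℤ[X]] p.asIdeal.ResidueField), φ ≠ 0 ∧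
      ∀ E : Finset p.asIdeal.ResidueField, ∃ n₀ : ℕ, ∀ n ≥ n₀, ∀ (k : ℕ)
        (d : Fin k → p.asIdeal.ResidueField), (∀ l, d l ∈ E) →
        ∑ l : Fin k, (X ^ (n * l) : ℤ[X]) • d l = 0 → ∀ l, d l = 0 := by
  obtain ⟨P, hP⟩ := associatedPrimes.nonempty ℤ[X] M
  obtain ⟨hprime, f, hf⟩ :=
    (isAssociatedPrime_iff_exists_injective_linearMap P M).1 hP
  let p : PrimeSpectrum ℤ[X] := ⟨P, hprime⟩
  have hsmul : ∀ (q : ℤ[X]) (y : ℤ[X] ⧸ P), q • y = Ideal.Quotient.mk P q * y :=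
    fun q y => Algebra.smul_def q y
  have hp : p ∈ Module.support ℤ[X] M := by
    refine Module.mem_support_iff'.2 ⟨f 1, fun r hr h => hr ?_⟩
    rw [← map_smul, map_eq_zero_iff f hf, hsmul, mul_one] at h
    exact Ideal.Quotient.eq_zero_iff_mem.1 h
  obtain ⟨φ, hφ⟩ := Module.exists_linearMap_residueField_ne_zero p hp
  have hX : Ideal.Quotient.mk P X ≠ 0 := fun h => by
    have := h0 (f 1) (by rw [← map_smul, hsmul, h, zero_mul, map_zero])
    exact one_ne_zero ((map_eq_zero_iff f hf).1 this)
  have hXm : ∀ m : ℕ, 1 ≤ m → Ideal.Quotient.mk P X ^ m ≠ 1 := fun m hm h => by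
    have := h1 m hm (f 1) (by rw [← map_smul, hsmul, map_pow, h, one_mul])
    exact one_ne_zero ((map_eq_zero_iff f hf).1 this)
  obtain ⟨v, hv⟩ := exists_absoluteValue_ne_one (a := Ideal.Quotient.mk P X) (fun y => by
    obtain ⟨q, rfl⟩ := Ideal.Quotient.mk_surjective y
    refine ⟨q, ?_⟩
    conv_rhs => rw [← aeval_X_left_apply q]
    exact aeval_algebraMap_apply (ℤ[X] ⧸ P) X q) hX hXm
  refine ⟨p, φ, hφ, fun E => ?_⟩
  obtain ⟨n₀, hn₀⟩ :=
    v.exists_forall_sum_pow_mul_algebraMap_eq_zero p.asIdeal.ResidueField hX hv E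
  refine ⟨n₀, fun n hn k d hd h => hn₀ n hn k d hd ?_⟩
  rw [← h]
  refine Finset.sum_congr rfl fun l _ => ?_
  rw [Algebra.smul_def, ← map_pow]
  rfl

/-- If multiplication by `X` is injective and aperiodic on a `ℤ[X]`-module, then, for large `n`, a
finite subset satisfies no nontrivial relation with coefficients powers of `X ^ n`. -/
theorem exists_forall_sum_X_pow_smul_eq_zero {M : Type*} [AddCommGroup M] [Module ℤ[X] M]
    (h0 : ∀ g : M, (X : ℤ[X]) • g = 0 → g = 0)
    (h1 : ∀ m : ℕ, 1 ≤ m → ∀ g : M, (X ^ m : ℤ[X]) • g = g → g = 0) (D : Finset M) :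
    ∃ n₀ : ℕ, ∀ n ≥ n₀, ∀ (k : ℕ) (d : Fin k → M), (∀ l, d l ∈ D) →
      ∑ l : Fin k, (X ^ (n * l) : ℤ[X]) • d l = 0 → ∀ l, d l = 0 := by
  classical
  induction D using Finset.strongInduction with
  | H D ih =>
    let N := Submodule.span ℤ[X] (D : Set M)
    rcases subsingleton_or_nontrivial N with hN | hN
    · exact ⟨0, fun n _ k d hd _ l => congrArg Subtype.val
        (Subsingleton.elim (⟨d l, Submodule.subset_span (hd l)⟩ : N) 0)⟩
    have : Module.Finite ℤ[X] N := .span_of_finite ℤ[X] D.finite_toSet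
    obtain ⟨p, φ, hφ, hE⟩ := exists_linearMap_residueField_ne_zero (M := N)
      (fun g hg => Subtype.ext (h0 g (congrArg Subtype.val hg)))
      fun m hm g hg => Subtype.ext (h1 m hm g (congrArg Subtype.val hg))
    have hsub : ∀ x ∈ D, x ∈ N := fun x hx => Submodule.subset_span hx
    let D' := D.filter fun x => ∃ h : x ∈ N, φ ⟨x, h⟩ = 0
    have hD' : D' ⊂ D := by
      refine Finset.filter_ssubset.2 ?_
      by_contra! hall
      exact hφ (LinearMap.ext_on (Submodule.span_span_coe_preimage (s := (D : Set M)))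
        fun x hx => (hall x hx).2)
    obtain ⟨n₁, hn₁⟩ := ih D' hD'
    obtain ⟨n₂, hn₂⟩ := hE (D.attach.image fun x : D => φ ⟨x, hsub x x.2⟩)
    refine ⟨max n₁ n₂, fun n hn k d hd h => ?_⟩
    have hφd := hn₂ n (le_of_max_le_right hn) k (fun l => φ ⟨d l, hsub _ (hd l)⟩)
      (fun l => Finset.mem_image_of_mem (fun x : D => φ ⟨x, hsub x x.2⟩)
        (Finset.mem_attach D ⟨d l, hd l⟩)) (by
        simp only [← map_smul, ← map_sum]
        rw [← map_zero φ]
        congr 1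
        exact Subtype.ext (by simpa using h))
    exact hn₁ n (le_of_max_le_left hn) k d
      (fun l => Finset.mem_filter.2 ⟨hd l, hsub _ (hd l), hφd l⟩) h

/-- Let `G` be an abelian group, `T` an injective aperiodic endomorphism of
`G`, and `X` a finite subset of `G`. Then there exists `n₀ ∈ ℕ` such that for all `n ≥ n₀`
and all `k ∈ ℕ`, the map `X^k → G`, `(x_1, …, x_k) ↦ ∑_{l=1}^k T^{n(l-1)} x_l`, is
injective. -/
theorem statement6 {G : Type*} [AddCommGroup G] (T : AddMonoid.End G)
    (hinj : Function.Injective T)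
    (haper : ∀ m : ℕ, 1 ≤ m → ∀ g : G, (T ^ m) g = g → g = 0)
    (X : Finset G) :
    ∃ n₀ : ℕ, ∀ n ≥ n₀, ∀ k : ℕ,
      Set.InjOn (fun y : Fin k → G => ∑ l : Fin k, (T ^ (n * (l : ℕ))) (y l))
        {y | ∀ l, y l ∈ X} := by
  classical
  let : Module ℤ[X] G :=
    Module.compHom G (Polynomial.aeval T : ℤ[X] →ₐ[ℤ] AddMonoid.End G).toRingHom
  have hX : ∀ (m : ℕ) (g : G), (Polynomial.X ^ m : ℤ[X]) • g = (T ^ m) g := fun m g => by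
    change Polynomial.aeval T (Polynomial.X ^ m : ℤ[X]) g = _
    rw [map_pow, Polynomial.aeval_X]
  obtain ⟨n₀, hn₀⟩ := exists_forall_sum_X_pow_smul_eq_zero (M := G)
    (fun g hg => (map_eq_zero_iff T hinj).1 (by simpa [hg] using (hX 1 g).symm))
    (fun m hm g hg => haper m hm g ((hX m g).symm.trans hg))
    ((X ×ˢ X).image fun x => x.1 - x.2)
  refine ⟨n₀, fun n hn k y hy z hz h => funext fun l => sub_eq_zero.1 ?_⟩
  refine hn₀ n hn k (fun l => y l - z l) (fun l => Finset.mem_image.2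
    ⟨(y l, z l), Finset.mem_product.2 ⟨hy l, hz l⟩, rfl⟩) ?_ l
  simp only [hX, map_sub, Finset.sum_sub_distrib]
  exact sub_eq_zero.2 h
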